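/- Characterization of the support of the self-consistent density of states: Let (a,S) be a data pair with a = a* ∈ 𝒜, ‖a‖ ≤ k₀, and S positivity-preserving and symmetric with S[x] ≤ k₁⟨x⟩·1 for all x ∈ 𝒜̄₊ and some k₀, k₁ > 0; let m be the solution of the associated Dyson equation and ρ the self-consistent density of states. Then, for every τ ∈ ℝ: lim_{η↓0} η/‖Im m(τ+iη)‖ = 0 if and only if τ ∈ supp ρ (equivalently, τ ∈ supp v). -/

import Mathlib

open MeasureTheory

noncomputable section

namespace Dyson

/-- A tracial, faithful, normal state on the C⋆-algebra `A` (our model for a finite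
von Neumann algebra together with its canonical tracial state). -/
structure TracialState (A : Type*) [CStarAlgebra A] [PartialOrder A] where
  tr : A →ₗ[ℂ] ℂ
  unital : tr 1 = 1
  tracial : ∀ x y : A, tr (x * y) = tr (y * x)
  state_pos : ∀ x : A, 0 ≤ x → 0 ≤ (tr x).re ∧ (tr x).im = 0
  faithful : ∀ x : A, 0 ≤ x → tr x = 0 → x = 0
  cont : Continuous tr

/-- A positive-operator-valued measure on `ℝ`, recorded through its values on sets of
reals together with the family of scalar measures `B ↦ ⟨x, v(B) x⟩`. -/
structure OpMeasure (A : Type*) [CStarAlgebra A] [PartialOrder A]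
    (φ : TracialState A) where
  val : Set ℝ → A
  nonneg : ∀ B : Set ℝ, 0 ≤ val B
  scalar : A → Measure ℝ
  scalarFin : ∀ x : A, IsFiniteMeasure (scalar x)
  compat : ∀ (x : A) (B : Set ℝ), MeasurableSet B →
    φ.tr (star x * val B * x) = Complex.ofReal ((scalar x) B).toReal

variable {A : Type*} [CStarAlgebra A] [PartialOrder A] [StarOrderedRing A]

/-- The real part `(x + x*)/2`. -/
def reA (x : A) : A := (2 : ℂ)⁻¹ • (x + star x)

/-- The imaginary part `(x − x*)/(2i)`. -/
def imA (x : A) : A := (2 * Complex.I)⁻¹ • (x - star x)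

/-- Strictly positive (positive definite) elements, i.e. `x ≥ ε·1` for some `ε > 0`. -/
def IsPosDef (x : A) : Prop := ∃ ε : ℝ, 0 < ε ∧ Complex.ofReal ε • (1 : A) ≤ x

/-- The scalar product `⟨x, y⟩ = τ(x* y)` induced by the state. -/
def inner2 (φ : TracialState A) (x y : A) : ℂ := φ.tr (star x * y)

/-- The `L²`-norm `‖x‖₂ = ⟨x*x⟩^{1/2}` induced by the state. -/
def nrm2 (φ : TracialState A) (x : A) : ℝ := Real.sqrt (φ.tr (star x * x)).re

/-- The `L² → L²` operator norm of a map on `A`. -/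
def opNorm2 (φ : TracialState A) (f : A → A) : ℝ :=
  sInf {C : ℝ | 0 ≤ C ∧ ∀ x : A, nrm2 φ (f x) ≤ C * nrm2 φ x}

/-- `S` preserves the cone of positive semidefinite elements. -/
def PosPreserving (S : A →L[ℂ] A) : Prop := ∀ x : A, 0 ≤ x → 0 ≤ S x

/-- `S` is symmetric with respect to `⟨x, y⟩ = τ(x* y)`. -/
def SymmOp (φ : TracialState A) (S : A →L[ℂ] A) : Prop :=
  ∀ x y : A, φ.tr (star (S x) * y) = φ.tr (star x * S y)

/-- Flatness: `c₁⟨x⟩·1 ≤ S[x] ≤ c₂⟨x⟩·1` for all positive semidefinite `x`. -/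
def IsFlat (φ : TracialState A) (S : A →L[ℂ] A) (c₁ c₂ : ℝ) : Prop :=
  ∀ x : A, 0 ≤ x →
    Complex.ofReal (c₁ * (φ.tr x).re) • (1 : A) ≤ S x ∧
      S x ≤ Complex.ofReal (c₂ * (φ.tr x).re) • (1 : A)

/-- `m` solves the Dyson equation `−m(z)⁻¹ = z·1 − a + S[m(z)]` on the upper half-plane,
with positive definite imaginary part. -/
def IsDysonSolution (a : A) (S : A →L[ℂ] A) (m : ℂ → A) : Prop :=
  ∀ z : ℂ, 0 < z.im →
    IsPosDef (imA (m z)) ∧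
    m z * (z • (1 : A) - a + S (m z)) = -1 ∧
    (z • (1 : A) - a + S (m z)) * m z = -1

/-- The support of an operator-valued measure. -/
def OpMeasure.supp {φ : TracialState A} (v : OpMeasure A φ) : Set ℝ :=
  {t : ℝ | ∀ ε : ℝ, 0 < ε → v.val (Set.Ioo (t - ε) (t + ε)) ≠ 0}

/-- The self-consistent density of states `ρ = ⟨v⟩ = ⟨1, v(·) 1⟩`. -/
def OpMeasure.dos {φ : TracialState A} (v : OpMeasure A φ) : Measure ℝ :=
  v.scalar 1

/-- `m` is the Stieltjes transform of `v`. -/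
def StieltjesRep (φ : TracialState A) (v : OpMeasure A φ) (m : ℂ → A) : Prop :=
  ∀ z : ℂ, 0 < z.im → ∀ x : A,
    φ.tr (star x * m z * x) = ∫ t : ℝ, ((t : ℂ) - z)⁻¹ ∂(v.scalar x)

/-- The support of a (positive) measure on `ℝ`. -/
def measSupp (μ : Measure ℝ) : Set ℝ :=
  {t : ℝ | ∀ ε : ℝ, 0 < ε → μ (Set.Ioo (t - ε) (t + ε)) ≠ 0}

/-- The harmonic extension `ρ(z) = ⟨Im m(z)⟩/π` of the density of states. -/
def rhoH (φ : TracialState A) (m : ℂ → A) (z : ℂ) : ℝ :=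
  (φ.tr (imA (m z))).re / Real.pi

end Dyson

namespace Dyson

section Algebra

variable {A : Type*} [CStarAlgebra A]

lemma isSelfAdjoint_reA (x : A) : IsSelfAdjoint (reA x) := by
  simp [IsSelfAdjoint, reA, star_smul, add_comm]

lemma isSelfAdjoint_imA (x : A) : IsSelfAdjoint (imA x) := by
  have h : star ((2 * Complex.I)⁻¹ : ℂ) = -(2 * Complex.I)⁻¹ := by
    simp
  rw [IsSelfAdjoint, imA, star_smul, h, star_sub, star_star, neg_smul, ← smul_neg, neg_sub]

lemma reA_add_I_smul_imA (x : A) : reA x + Complex.I • imA x = x := by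
  have h : Complex.I * (2 * Complex.I)⁻¹ = (2 : ℂ)⁻¹ := by
    field_simp
  rw [reA, imA, smul_smul, h, ← smul_add, add_add_sub_cancel, ← two_smul ℂ x, smul_smul]
  norm_num

lemma sub_star_eq_imA (x : A) : x - star x = (2 * Complex.I) • imA x := by
  rw [imA, smul_smul, mul_inv_cancel₀ (by simp), one_smul]

lemma norm_reA_le (x : A) : ‖reA x‖ ≤ ‖x‖ := by
  rw [reA, norm_smul]
  have h := norm_add_le x (star x)
  rw [norm_star] at h
  norm_num
  linarith

lemma norm_imA_le (x : A) : ‖imA x‖ ≤ ‖x‖ := by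
  rw [imA, norm_smul]
  have h := norm_sub_le x (star x)
  rw [norm_star] at h
  norm_num
  linarith

lemma norm_le_reA_add_imA (x : A) : ‖x‖ ≤ ‖reA x‖ + ‖imA x‖ := by
  calc ‖x‖ = ‖reA x + Complex.I • imA x‖ := by rw [reA_add_I_smul_imA]
    _ ≤ ‖reA x‖ + ‖Complex.I • imA x‖ := norm_add_le _ _
    _ = ‖reA x‖ + ‖imA x‖ := by rw [norm_smul, Complex.norm_I, one_mul]

lemma imA_add (x y : A) : imA (x + y) = imA x + imA y := by
  rw [imA, imA, imA, ← smul_add, star_add, add_sub_add_comm]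

lemma imA_sub (x y : A) : imA (x - y) = imA x - imA y := by
  rw [imA, imA, imA, ← smul_sub, star_sub, sub_sub_sub_comm]

lemma imA_eq_zero {x : A} (hx : IsSelfAdjoint x) : imA x = 0 := by
  rw [imA, hx.star_eq, sub_self, smul_zero]

lemma imA_neg_star (x : A) : imA (-star x) = imA x := by
  rw [imA, imA, star_neg, star_star]
  congr 1
  abel

lemma imA_star_mul_mul (x y : A) : imA (star x * y * x) = star x * imA y * x := by
  simp only [imA, star_mul, star_star, mul_smul_comm, smul_mul_assoc, mul_sub, sub_mul, mul_assoc]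

lemma imA_smul_one (z : ℂ) : imA (z • (1 : A)) = z.im • (1 : A) := by
  have h : (2 * Complex.I)⁻¹ * (z - star z) = (z.im : ℂ) := by
    have : z - star z = (2 * Complex.I) * z.im := by
      simp [Complex.ext_iff]
      ring
    rw [this, inv_mul_cancel_left₀ (by simp)]
  rw [imA, star_smul, star_one, ← sub_smul, smul_smul, h, Complex.coe_smul]

end Algebra

section Order

variable {A : Type*} [CStarAlgebra A] [PartialOrder A] [StarOrderedRing A]

lemma le_norm_smul_one {x : A} (hx : IsSelfAdjoint x) : x ≤ ‖x‖ • (1 : A) := by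
  have h := hx.le_algebraMap_norm_self
  rwa [Algebra.algebraMap_eq_smul_one] at h

lemma norm_le_of_le_smul_one {x : A} (hx : IsSelfAdjoint x) {r : ℝ} (hr : 0 ≤ r)
    (h1 : x ≤ r • (1 : A)) (h2 : -x ≤ r • (1 : A)) : ‖x‖ ≤ r := by
  rcases subsingleton_or_nontrivial A with hA | hA
  · rwa [Subsingleton.elim x 0, norm_zero]
  rw [neg_le, ← neg_smul] at h2
  rw [← Algebra.algebraMap_eq_smul_one] at h1 h2
  rw [le_algebraMap_iff_spectrum_le] at h1
  rw [algebraMap_le_iff_le_spectrum] at h2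
  rcases CStarAlgebra.norm_or_neg_norm_mem_spectrum hx with h | h
  · exact h1 _ h
  · linarith [h2 _ h]

lemma norm_le_of_nonneg_of_le_smul_one {x : A} (hx : 0 ≤ x) {r : ℝ} (hr : 0 ≤ r)
    (h : x ≤ r • (1 : A)) : ‖x‖ ≤ r := by
  rw [← Algebra.algebraMap_eq_smul_one] at h
  exact (CStarAlgebra.norm_le_iff_le_algebraMap x hr).2 h

lemma PosPreserving.monotone {S : A →L[ℂ] A} (hS : PosPreserving S) : Monotone S := by
  intro x y hxy
  have h := hS (y - x) (sub_nonneg.2 hxy)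
  rwa [map_sub, sub_nonneg] at h

lemma PosPreserving.isSelfAdjoint {S : A →L[ℂ] A} (hS : PosPreserving S) {x : A}
    (hx : IsSelfAdjoint x) : IsSelfAdjoint (S x) := by
  have h1 := (hS (‖x‖ • (1 : A)) (smul_nonneg (norm_nonneg x) zero_le_one)).isSelfAdjoint
  have h2 := (hS (‖x‖ • (1 : A) - x) (sub_nonneg.2 (le_norm_smul_one hx))).isSelfAdjoint
  have h3 := h1.sub h2
  rwa [← map_sub, sub_sub_cancel] at h3

lemma PosPreserving.map_star {S : A →L[ℂ] A} (hS : PosPreserving S) (x : A) :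
    S (star x) = star (S x) := by
  have h1 := (hS.isSelfAdjoint (isSelfAdjoint_reA x)).star_eq
  have h2 := (hS.isSelfAdjoint (isSelfAdjoint_imA x)).star_eq
  have hx : star x = reA x - Complex.I • imA x := by
    conv_lhs => rw [← reA_add_I_smul_imA x]
    rw [star_add, star_smul, (isSelfAdjoint_reA x).star_eq, (isSelfAdjoint_imA x).star_eq]
    simp [sub_eq_add_neg]
  rw [hx]
  conv_rhs => rw [← reA_add_I_smul_imA x]
  rw [map_sub, map_add, map_smul, star_add, star_smul, h1, h2]
  simp [sub_eq_add_neg]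

lemma PosPreserving.map_imA {S : A →L[ℂ] A} (hS : PosPreserving S) (x : A) :
    S (imA x) = imA (S x) := by
  rw [imA, imA, map_smul, map_sub, hS.map_star]

lemma PosPreserving.map_reA {S : A →L[ℂ] A} (hS : PosPreserving S) (x : A) :
    S (reA x) = reA (S x) := by
  rw [reA, reA, map_smul, map_add, hS.map_star]

/-- A positivity-preserving map with a strictly subinvariant positive definite element `h` is a
contraction in the order norm of `h`, so `1 - T` is bounded below on self-adjoint elements. -/
lemma PosPreserving.norm_le_of_isSelfAdjoint {T : A →L[ℂ] A} (hT : PosPreserving T) {h : A}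
    {c C q : ℝ} (hc : 0 < c) (hC : 0 ≤ C) (hq0 : 0 ≤ q) (hq1 : q < 1) (h1 : c • (1 : A) ≤ h)
    (h2 : h ≤ C • (1 : A)) (hTh : T h ≤ q • h) {x : A} (hx : IsSelfAdjoint x) :
    ‖x‖ ≤ C / (c * (1 - q)) * ‖x - T x‖ := by
  have hreal : ∀ (r : ℝ) (y : A), T (r • y) = r • T y := fun r y => by
    rw [← Complex.coe_smul, map_smul, Complex.coe_smul]
  have hh : 0 ≤ h := (smul_nonneg hc.le zero_le_one).trans h1
  -- one-sided bound, for `x` and `-x`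
  have key : ∀ y : A, IsSelfAdjoint y → ∀ n : ℕ,
      y ≤ (‖y - T y‖ / (c * (1 - q)) + q ^ n * (‖y‖ / c)) • h := by
    intro y hy n
    have hdom : ∀ w : A, IsSelfAdjoint w → w ≤ (‖w‖ / c) • h := fun w hw => by
      refine (le_norm_smul_one hw).trans ?_
      have h3 := smul_le_smul_of_nonneg_left h1 (div_nonneg (norm_nonneg w) hc.le)
      rwa [smul_smul, div_mul_cancel₀ _ hc.ne'] at h3
    induction n with
    | zero =>
      refine (hdom y hy).trans (smul_le_smul_of_nonneg_right ?_ hh)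
      have : 0 ≤ ‖y - T y‖ / (c * (1 - q)) :=
        div_nonneg (norm_nonneg _) (mul_nonneg hc.le (by linarith))
      simpa using this
    | succ n ih =>
      have h3 := hT.monotone ih
      rw [hreal] at h3
      set r := ‖y - T y‖ / (c * (1 - q)) + q ^ n * (‖y‖ / c) with hr
      have hr0 : 0 ≤ r := add_nonneg
        (div_nonneg (norm_nonneg _) (mul_nonneg hc.le (by linarith)))
        (mul_nonneg (pow_nonneg hq0 n) (div_nonneg (norm_nonneg _) hc.le))
      have h4 := h3.trans (smul_le_smul_of_nonneg_left hTh hr0)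
      have h5 := add_le_add (hdom _ (hy.sub (hT.isSelfAdjoint hy))) h4
      rw [sub_add_cancel, smul_smul, ← add_smul] at h5
      refine h5.trans_eq ?_
      congr 1
      have : (1 - q) ≠ 0 := by linarith
      rw [hr]
      field_simp
      ring
  have hn : ∀ n : ℕ, ‖x‖ ≤ (‖x - T x‖ / (c * (1 - q)) + q ^ n * (‖x‖ / c)) * C := by
    intro n
    set r := ‖x - T x‖ / (c * (1 - q)) + q ^ n * (‖x‖ / c) with hr
    have hr0 : 0 ≤ r := add_nonneg
      (div_nonneg (norm_nonneg _) (mul_nonneg hc.le (by linarith)))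
      (mul_nonneg (pow_nonneg hq0 n) (div_nonneg (norm_nonneg _) hc.le))
    have h3 := smul_le_smul_of_nonneg_left h2 hr0
    rw [smul_smul] at h3
    refine norm_le_of_le_smul_one hx (mul_nonneg hr0 hC) ((key x hx n).trans h3) ?_
    have h4 := key (-x) hx.neg n
    rw [map_neg, ← neg_sub', norm_neg, norm_neg] at h4
    exact h4.trans h3
  have hlim : Filter.Tendsto (fun n : ℕ => (‖x - T x‖ / (c * (1 - q)) + q ^ n * (‖x‖ / c)) * C)
      Filter.atTop (nhds ((‖x - T x‖ / (c * (1 - q)) + 0 * (‖x‖ / c)) * C)) :=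
    (((tendsto_pow_atTop_nhds_zero_of_lt_one hq0 hq1).mul_const _).const_add _).mul_const _
  refine (ge_of_tendsto' hlim hn).trans_eq ?_
  ring

lemma PosPreserving.norm_le {T : A →L[ℂ] A} (hT : PosPreserving T) {h : A}
    {c C q : ℝ} (hc : 0 < c) (hC : 0 ≤ C) (hq0 : 0 ≤ q) (hq1 : q < 1) (h1 : c • (1 : A) ≤ h)
    (h2 : h ≤ C • (1 : A)) (hTh : T h ≤ q • h) (x : A) :
    ‖x‖ ≤ 2 * (C / (c * (1 - q))) * ‖x - T x‖ := by
  have hB : 0 ≤ C / (c * (1 - q)) := div_nonneg hC (mul_nonneg hc.le (by linarith))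
  have hre := hT.norm_le_of_isSelfAdjoint hc hC hq0 hq1 h1 h2 hTh (isSelfAdjoint_reA x)
  have him := hT.norm_le_of_isSelfAdjoint hc hC hq0 hq1 h1 h2 hTh (isSelfAdjoint_imA x)
  have e1 : reA x - T (reA x) = reA (x - T x) := by
    rw [hT.map_reA, reA, reA, reA, ← smul_sub, star_sub, add_sub_add_comm]
  rw [e1] at hre
  rw [hT.map_imA, ← imA_sub] at him
  have h3 := mul_le_mul_of_nonneg_left (norm_reA_le (x - T x)) hB
  have h4 := mul_le_mul_of_nonneg_left (norm_imA_le (x - T x)) hB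
  linarith [norm_le_reA_add_imA x]

end Order

section LocalBound

variable {A : Type*} [CStarAlgebra A] [PartialOrder A] [StarOrderedRing A]

/-- The imaginary part of the Dyson equation. -/
lemma IsDysonSolution.imA_eq {a : A} {S : A →L[ℂ] A} {m : ℂ → A} (hm : IsDysonSolution a S m)
    (ha : IsSelfAdjoint a) (hS : PosPreserving S) {z : ℂ} (hz : 0 < z.im) :
    imA (m z) = z.im • (star (m z) * m z) + star (m z) * S (imA (m z)) * m z := by
  obtain ⟨-, -, h2⟩ := hm z hz
  have h3 : star (m z) * (z • (1 : A) - a + S (m z)) * m z = -star (m z) := by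
    rw [mul_assoc, h2, mul_neg, mul_one]
  have h4 : imA (z • (1 : A) - a + S (m z)) = z.im • (1 : A) + S (imA (m z)) := by
    rw [imA_add, imA_sub, imA_smul_one, imA_eq_zero ha, sub_zero, hS.map_imA]
  have h5 : imA (m z) = star (m z) * (z.im • (1 : A) + S (imA (m z))) * m z := by
    rw [← h4, ← imA_star_mul_mul, h3, imA_neg_star]
  nth_rewrite 1 [h5]
  rw [mul_add, add_mul, mul_smul_comm, smul_mul_assoc, mul_one]

lemma IsPosDef.nonneg {x : A} (hx : IsPosDef x) : 0 ≤ x := by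
  obtain ⟨ε, hε, h⟩ := hx
  rw [Complex.coe_smul] at h
  exact (smul_nonneg hε.le zero_le_one).trans h

/-- The positivity-preserving map `x ↦ m* S[x] m`. -/
def conjOp (S : A →L[ℂ] A) (m : A) : A →L[ℂ] A :=
  (ContinuousLinearMap.mul ℂ A).flip m ∘L ContinuousLinearMap.mul ℂ A (star m) ∘L S

omit [PartialOrder A] [StarOrderedRing A] in
lemma conjOp_apply (S : A →L[ℂ] A) (m x : A) : conjOp S m x = star m * S x * m := rfl

lemma PosPreserving.conjOp {S : A →L[ℂ] A} (hS : PosPreserving S) (m : A) :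
    PosPreserving (conjOp S m) := fun x hx => by
  rw [conjOp_apply]
  exact star_left_conjugate_nonneg (hS x hx) m

/-- If `‖Im m‖ ≤ C Im z` then `‖m‖² ≤ C`. -/
lemma IsDysonSolution.norm_sq_le {a : A} {S : A →L[ℂ] A} {m : ℂ → A} (hm : IsDysonSolution a S m)
    (ha : IsSelfAdjoint a) (hS : PosPreserving S) {z : ℂ} (hz : 0 < z.im) {C : ℝ}
    (h : ‖imA (m z)‖ ≤ C * z.im) : ‖m z‖ ^ 2 ≤ C := by
  have h1 := hm.imA_eq ha hS hz
  have hg : 0 ≤ imA (m z) := (hm z hz).1.nonneg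
  have h2 : z.im • (star (m z) * m z) ≤ imA (m z) := by
    refine (?_ : _ ≤ _).trans_eq h1.symm
    exact le_add_of_nonneg_right (star_left_conjugate_nonneg (hS _ hg) _)
  have h3 := CStarAlgebra.norm_le_norm_of_nonneg_of_le
    (smul_nonneg hz.le (star_mul_self_nonneg (m z))) h2
  rw [norm_smul, Real.norm_of_nonneg hz.le, CStarRing.norm_star_mul_self, ← sq] at h3
  nlinarith

/-- If `‖Im m‖ ≤ C Im z`, then `1 - m* S[·] m` is bounded below, uniformly in terms of `C` and a
bound `N` for the inverse of `m`. -/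
lemma IsDysonSolution.norm_le_sub_conjOp {a : A} {S : A →L[ℂ] A} {m : ℂ → A}
    (hm : IsDysonSolution a S m) (ha : IsSelfAdjoint a) (hS : PosPreserving S) {C N : ℝ}
    (hC : 0 < C) (hN : 0 < N) :
    ∃ B : ℝ, 0 < B ∧ ∀ z : ℂ, 0 < z.im → ‖imA (m z)‖ ≤ C * z.im →
      ‖z • (1 : A) - a + S (m z)‖ ≤ N → ∀ x : A, ‖x‖ ≤ B * ‖x - star (m z) * S x * m z‖ := by
  set c : ℝ := (N ^ 2)⁻¹ with hc_def
  have hc : 0 < c := by positivity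
  set q : ℝ := 1 - c / (C + c) with hq_def
  have hq1 : q < 1 := by
    have : 0 < c / (C + c) := by positivity
    linarith
  have hq0 : 0 ≤ q := by
    have : c / (C + c) ≤ 1 := (div_le_one (by positivity)).2 (by linarith)
    linarith
  refine ⟨2 * ((C + c) / (c * (1 - q))), ?_, ?_⟩
  · have : 0 < 1 - q := by linarith
    positivity
  intro z hz hC' hN' x
  have hg : 0 ≤ imA (m z) := (hm z hz).1.nonneg
  set h : A := (z.im)⁻¹ • imA (m z) with hh
  have hz' : z.im ≠ 0 := hz.ne'
  have himA : imA (m z) = z.im • h := by rw [hh, smul_smul, mul_inv_cancel₀ hz', one_smul]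
  have heq : h = star (m z) * m z + conjOp S (m z) h := by
    have h1 := hm.imA_eq ha hS hz
    rw [← conjOp_apply, himA, ← Complex.coe_smul, ← Complex.coe_smul, map_smul, ← smul_add] at h1
    exact smul_right_injective A (by exact_mod_cast hz') h1
  have hh0 : 0 ≤ h := smul_nonneg (inv_nonneg.2 hz.le) hg
  have hmm : c • (1 : A) ≤ star (m z) * m z := by
    obtain ⟨-, -, hn⟩ := hm z hz
    set n : A := z • (1 : A) - a + S (m z)
    have h1 := star_left_conjugate_le_conjugate
      (CStarAlgebra.star_mul_le_algebraMap_norm_sq (a := n)) (m z)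
    have h2 : star (m z) * (star n * n) * m z = 1 := by
      have : star (m z) * (star n * n) * m z = star (n * m z) * (n * m z) := by
        simp only [star_mul, mul_assoc]
      rw [this, hn]
      simp
    rw [h2, Algebra.algebraMap_eq_smul_one, mul_smul_comm, smul_mul_assoc, mul_one] at h1
    have h3 : (‖n‖ ^ 2) • (star (m z) * m z) ≤ (N ^ 2) • (star (m z) * m z) :=
      smul_le_smul_of_nonneg_right (pow_le_pow_left₀ (norm_nonneg _) hN' 2)
        (star_mul_self_nonneg _)
    have h4 := smul_le_smul_of_nonneg_left (h1.trans h3) hc.le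
    rwa [smul_smul, hc_def, inv_mul_cancel₀ (by positivity), one_smul] at h4
  have hle : h ≤ (C + c) • (1 : A) := by
    refine (le_norm_smul_one hh0.isSelfAdjoint).trans (smul_le_smul_of_nonneg_right ?_ zero_le_one)
    rw [hh, norm_smul, norm_inv, Real.norm_of_nonneg hz.le, inv_mul_le_iff₀ hz]
    nlinarith
  have hTh : conjOp S (m z) h ≤ q • h := by
    have h1 : conjOp S (m z) h = h - star (m z) * m z := by
      nth_rewrite 2 [heq]
      abel
    have h2 := smul_le_smul_of_nonneg_left hle (by positivity : 0 ≤ c / (C + c))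
    rw [smul_smul (c / (C + c)) (C + c), div_mul_cancel₀ c (by positivity)] at h2
    rw [h1, hq_def, sub_smul, one_smul]
    exact sub_le_sub_left (h2.trans hmm) _
  have hch : c • (1 : A) ≤ h := by
    rw [heq]
    exact hmm.trans (le_add_of_nonneg_right (hS.conjOp _ _ hh0))
  exact (hS.conjOp (m z)).norm_le hc (by positivity) hq0 hq1 hch hle hTh x

omit [StarOrderedRing A] in
/-- The Dyson equation at two spectral parameters. -/
lemma IsDysonSolution.sub_eq {a : A} {S : A →L[ℂ] A} {m : ℂ → A} (hm : IsDysonSolution a S m)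
    {z w : ℂ} (hz : 0 < z.im) (hw : 0 < w.im) :
    m w - m z = m w * ((w - z) • (1 : A) + S (m w - m z)) * m z := by
  obtain ⟨-, -, h1⟩ := hm z hz
  obtain ⟨-, h2, -⟩ := hm w hw
  have h3 : (w - z) • (1 : A) + S (m w - m z)
      = (w • (1 : A) - a + S (m w)) - (z • (1 : A) - a + S (m z)) := by
    rw [sub_smul, map_sub]
    abel
  rw [h3, mul_sub, sub_mul, h2, mul_assoc (m w) _ (m z), h1]
  simp only [neg_mul, mul_neg, one_mul, mul_one]
  abel

set_option maxHeartbeats 1000000 in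
/-- If `‖Im m‖ ≤ C Im z` at some point close enough to `τ`, then the same bound holds with another
constant in a whole neighbourhood of `τ` in the upper half-plane. -/
lemma IsDysonSolution.exists_local_bound {a : A} {S : A →L[ℂ] A} {m : ℂ → A}
    (hm : IsDysonSolution a S m) (ha : IsSelfAdjoint a) (hS : PosPreserving S)
    (hcont : ContinuousOn m {z : ℂ | 0 < z.im}) (τ : ℂ) {C : ℝ} (hC : 0 < C) :
    ∃ δ > 0, ∃ C' > 0, ∀ z₀ : ℂ, 0 < z₀.im → ‖z₀ - τ‖ < δ → z₀.im < δ →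
      ‖imA (m z₀)‖ ≤ C * z₀.im →
      ∀ z : ℂ, 0 < z.im → ‖z - τ‖ < δ → ‖imA (m z)‖ ≤ C' * z.im := by
  set s := ‖S‖ with hs
  have hs0 : 0 ≤ s := norm_nonneg S
  set M := C + 1 with hM
  have hM0 : 0 < M := by positivity
  obtain ⟨B, hB, hstab⟩ := hm.norm_le_sub_conjOp ha hS hC
    (N := ‖τ‖ + 1 + ‖(1 : A)‖ * (‖τ‖ + 1) + ‖a‖ + s * M) (by positivity)
  set r := (4 * (B * s * (2 * M + 1)) + 1)⁻¹ with hr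
  have hr0 : 0 < r := by positivity
  have hr1 : r ≤ 1 := inv_le_one_of_one_le₀ (by
    have : 0 ≤ B * s * (2 * M + 1) := by positivity
    linarith)
  have hBr : B * s * (2 * M + 1) * r ≤ 1 / 4 := by
    have : 0 < 4 * (B * s * (2 * M + 1)) + 1 := by positivity
    rw [hr, ← div_eq_mul_inv, div_le_iff₀ this]
    linarith
  set K := 2 * B * ‖(1 : A)‖ * M ^ 2 + 2 * B * ‖(1 : A)‖ * r * M + 2 * B * C * s * M * r with hK
  have hK0 : 0 ≤ K := by positivity
  set δ := r / (4 * (K + 1)) with hδ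
  have hδ0 : 0 < δ := by positivity
  have hδ1 : δ ≤ 1 := (div_le_one (by positivity)).2 (by linarith)
  have hδK : δ * K ≤ r / 4 := by
    rw [hδ, div_mul_eq_mul_div, div_le_div_iff₀ (by positivity) (by positivity)]
    nlinarith
  refine ⟨δ, hδ0, 2 * B * (M + 1) ^ 2, by positivity, ?_⟩
  intro z₀ hz₀ hz₀τ hz₀δ hz₀C
  have hm0 : ‖m z₀‖ ≤ M := by
    have h1 := hm.norm_sq_le ha hS hz₀ hz₀C
    nlinarith [norm_nonneg (m z₀)]
  have hSle : ∀ x : A, ‖S x‖ ≤ s * ‖x‖ := fun x => S.le_opNorm x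
  have hstab0 : ∀ x : A, ‖x‖ ≤ B * ‖x - star (m z₀) * S x * m z₀‖ := by
    refine hstab z₀ hz₀ hz₀C ?_
    have hz₀n : ‖z₀‖ ≤ ‖τ‖ + 1 := by
      have := norm_le_norm_add_norm_sub' z₀ τ
      linarith
    have h1 : ‖z₀ • (1 : A)‖ ≤ ‖(1 : A)‖ * (‖τ‖ + 1) := by
      rw [norm_smul, mul_comm]
      exact mul_le_mul_of_nonneg_left hz₀n (norm_nonneg _)
    have h2 : ‖S (m z₀)‖ ≤ s * M := (hSle _).trans (mul_le_mul_of_nonneg_left hm0 hs0)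
    have h3 := norm_add_le (z₀ • (1 : A) - a) (S (m z₀))
    have h4 := norm_sub_le (z₀ • (1 : A)) a
    linarith [norm_nonneg τ]
  -- the difference `m z - m z₀` never has norm exactly `r`
  have hne : ∀ z : ℂ, 0 < z.im → ‖z - z₀‖ < 2 * δ → ‖m z - m z₀‖ ≠ r := by
    intro z hz hzδ hzr
    set D := m z - m z₀ with hD
    have hmz : m z = m z₀ + D := by rw [hD]; abel
    have heq : D - star (m z₀) * S D * m z₀
        = (m z₀ * ((z - z₀) • (1 : A)) * m z₀ + D * ((z - z₀) • (1 : A)) * m z₀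
          + D * S D * m z₀) + (m z₀ - star (m z₀)) * S D * m z₀ := by
      have h1 := hm.sub_eq hz₀ hz
      rw [← hD, hmz] at h1
      nth_rewrite 1 [h1]
      simp only [mul_add, add_mul, sub_mul]
      abel
    have hSD : ‖S D‖ ≤ s * r := hzr ▸ hSle D
    have hz1 : ‖(z - z₀) • (1 : A)‖ ≤ 2 * δ * ‖(1 : A)‖ := by
      rw [norm_smul]
      exact mul_le_mul_of_nonneg_right hzδ.le (norm_nonneg _)
    have h1 : ‖m z₀ * ((z - z₀) • (1 : A)) * m z₀‖ ≤ M * (2 * δ * ‖(1 : A)‖) * M :=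
      norm_mul_le_of_le (norm_mul_le_of_le hm0 hz1) hm0
    have h2 : ‖D * ((z - z₀) • (1 : A)) * m z₀‖ ≤ r * (2 * δ * ‖(1 : A)‖) * M :=
      norm_mul_le_of_le (norm_mul_le_of_le hzr.le hz1) hm0
    have h3 : ‖D * S D * m z₀‖ ≤ r * (s * r) * M :=
      norm_mul_le_of_le (norm_mul_le_of_le hzr.le hSD) hm0
    have h4 : ‖m z₀ - star (m z₀)‖ ≤ 2 * (C * δ) := by
      rw [sub_star_eq_imA, norm_smul]
      have : C * z₀.im ≤ C * δ := mul_le_mul_of_nonneg_left hz₀δ.le hC.le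
      norm_num
      linarith
    have h5 : ‖(m z₀ - star (m z₀)) * S D * m z₀‖ ≤ 2 * (C * δ) * (s * r) * M :=
      norm_mul_le_of_le (norm_mul_le_of_le h4 hSD) hm0
    have h6 := hstab0 D
    rw [heq, hzr] at h6
    have h7 := mul_le_mul_of_nonneg_left (norm_add_le_of_le (norm_add_le_of_le (norm_add_le_of_le h1 h2) h3) h5) hB.le
    have h8 := h6.trans h7
    have h9 : B * (M * (2 * δ * ‖(1 : A)‖) * M + r * (2 * δ * ‖(1 : A)‖) * M + r * (s * r) * M
        + 2 * (C * δ) * (s * r) * M) = δ * K + (B * s * M * r) * r := by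
      rw [hK]
      ring
    rw [h9] at h8
    have h10 : B * s * M * r ≤ 1 / 4 := by
      refine le_trans ?_ hBr
      refine mul_le_mul_of_nonneg_right ?_ hr0.le
      exact mul_le_mul_of_nonneg_left (by linarith) (by positivity)
    nlinarith
  have hlt : ∀ z : ℂ, 0 < z.im → ‖z - z₀‖ < 2 * δ → ‖m z - m z₀‖ < r := by
    intro z hz hzδ
    by_contra hge
    rw [not_lt] at hge
    set γ : ℝ → ℂ := fun t => z₀ + (t : ℂ) * (z - z₀) with hγ
    have hγim : ∀ t ∈ Set.Icc (0 : ℝ) 1, 0 < (γ t).im := by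
      intro t ht
      have : (γ t).im = (1 - t) * z₀.im + t * z.im := by
        simp [hγ]
        ring
      rw [this]
      rcases eq_or_lt_of_le ht.1 with h0 | h0
      · rw [← h0]
        simpa using hz₀
      · exact add_pos_of_nonneg_of_pos (mul_nonneg (by linarith [ht.2]) hz₀.le) (mul_pos h0 hz)
    have hγc : ContinuousOn (fun t => ‖m (γ t) - m z₀‖) (Set.Icc 0 1) := by
      refine ((hcont.comp (by fun_prop) hγim).sub continuousOn_const).norm
    have hmem : r ∈ Set.Icc ‖m (γ 0) - m z₀‖ ‖m (γ 1) - m z₀‖ := by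
      have h0 : γ 0 = z₀ := by simp [hγ]
      have h1 : γ 1 = z := by simp [hγ]
      rw [h0, h1, sub_self, norm_zero]
      exact ⟨hr0.le, hge⟩
    obtain ⟨t, ht, htr⟩ := intermediate_value_Icc zero_le_one hγc hmem
    refine hne (γ t) (hγim t ht) ?_ htr
    have : γ t - z₀ = (t : ℂ) * (z - z₀) := by simp [hγ]
    rw [this, norm_mul, Complex.norm_real, Real.norm_of_nonneg ht.1]
    exact (mul_le_of_le_one_left (norm_nonneg _) ht.2).trans_lt hzδ
  intro z hz hzτ
  have hzz : ‖z - z₀‖ < 2 * δ := by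
    have := norm_sub_le (z - τ) (z₀ - τ)
    rw [sub_sub_sub_cancel_right] at this
    linarith
  have hDr := (hlt z hz hzz).le
  set D := m z - m z₀ with hD
  set g := imA (m z) with hg
  have hmz : ‖m z‖ ≤ M + 1 := by
    have := norm_le_norm_add_norm_sub' (m z) (m z₀)
    linarith
  have heq : g - star (m z₀) * S g * m z₀
      = z.im • (star (m z) * m z) + (star D * S g * m z + star (m z₀) * S g * D) := by
    have h1 := hm.imA_eq ha hS hz
    rw [← hg] at h1
    nth_rewrite 1 [h1]
    rw [hD, star_sub]
    noncomm_ring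
  have hSg : ‖S g‖ ≤ s * ‖g‖ := hSle g
  have h1 : ‖z.im • (star (m z) * m z)‖ ≤ z.im * (M + 1) ^ 2 := by
    rw [norm_smul, Real.norm_of_nonneg hz.le, CStarRing.norm_star_mul_self, ← sq]
    exact mul_le_mul_of_nonneg_left (pow_le_pow_left₀ (norm_nonneg _) hmz 2) hz.le
  have h2 : ‖star D * S g * m z‖ ≤ r * (s * ‖g‖) * (M + 1) :=
    norm_mul_le_of_le (norm_mul_le_of_le ((norm_star D).trans_le hDr) hSg) hmz
  have h3 : ‖star (m z₀) * S g * D‖ ≤ M * (s * ‖g‖) * r :=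
    norm_mul_le_of_le (norm_mul_le_of_le ((norm_star _).trans_le hm0) hSg) hDr
  have h4 := hstab0 g
  rw [heq] at h4
  have h5 := h4.trans
    (mul_le_mul_of_nonneg_left (norm_add_le_of_le h1 (norm_add_le_of_le h2 h3)) hB.le)
  have h6 : B * (z.im * (M + 1) ^ 2 + (r * (s * ‖g‖) * (M + 1) + M * (s * ‖g‖) * r))
      = B * (M + 1) ^ 2 * z.im + (B * s * (2 * M + 1) * r) * ‖g‖ := by ring
  rw [h6] at h5
  have h7 : 0 ≤ B * (M + 1) ^ 2 * z.im := by positivity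
  nlinarith [norm_nonneg g]

end LocalBound

section Trace

variable {A : Type*} [CStarAlgebra A] [PartialOrder A] [StarOrderedRing A] (φ : TracialState A)

omit [StarOrderedRing A] in
include φ in
lemma TracialState.nontrivial : Nontrivial A := by
  refine ⟨1, 0, fun h => ?_⟩
  have h1 := φ.unital
  rw [h, map_zero] at h1
  exact zero_ne_one h1

lemma TracialState.im_eq_zero {x : A} (hx : IsSelfAdjoint x) : (φ.tr x).im = 0 := by
  have h1 := (φ.state_pos (‖x‖ • (1 : A)) (smul_nonneg (norm_nonneg x) zero_le_one)).2
  have h2 := (φ.state_pos (‖x‖ • (1 : A) - x) (sub_nonneg.2 (le_norm_smul_one hx))).2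
  rw [map_sub, Complex.sub_im, h1, zero_sub, neg_eq_zero] at h2
  exact h2

lemma TracialState.re_le_norm {x : A} (hx : IsSelfAdjoint x) : (φ.tr x).re ≤ ‖x‖ := by
  have h2 := (φ.state_pos (‖x‖ • (1 : A) - x) (sub_nonneg.2 (le_norm_smul_one hx))).1
  rw [map_sub, Complex.sub_re, ← Complex.coe_smul, map_smul, φ.unital] at h2
  simpa using h2

lemma TracialState.tr_eq (x : A) :
    φ.tr x = ((φ.tr (reA x)).re : ℂ) + Complex.I * ((φ.tr (imA x)).re : ℂ) := by
  have h1 := φ.im_eq_zero (isSelfAdjoint_reA x)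
  have h2 := φ.im_eq_zero (isSelfAdjoint_imA x)
  conv_lhs => rw [← reA_add_I_smul_imA x, map_add, map_smul]
  apply Complex.ext <;> simp [h1, h2]

lemma TracialState.re_tr_reA (x : A) : (φ.tr (reA x)).re = (φ.tr x).re := by
  rw [φ.tr_eq x]
  simp

lemma TracialState.re_tr_imA (x : A) : (φ.tr (imA x)).re = (φ.tr x).im := by
  rw [φ.tr_eq x]
  simp

omit [PartialOrder A] [StarOrderedRing A] in
lemma reA_star_mul_mul (x y : A) : reA (star x * y * x) = star x * reA y * x := by
  simp only [reA, star_mul, star_star, mul_smul_comm, smul_mul_assoc, mul_add, add_mul, mul_assoc]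

lemma TracialState.nonneg_of_re_conj_nonneg {y : A} (hy : IsSelfAdjoint y)
    (h : ∀ x : A, 0 ≤ (φ.tr (star x * y * x)).re) : 0 ≤ y := by
  have hn : 0 ≤ y⁻ := CFC.negPart_nonneg y
  have hns : star y⁻ = y⁻ := hn.isSelfAdjoint.star_eq
  have e : star y⁻ * y * y⁻ = -(star y⁻ * y⁻ * y⁻) := by
    nth_rewrite 2 [← CFC.posPart_sub_negPart y hy]
    rw [mul_assoc, sub_mul, CFC.posPart_mul_negPart, zero_sub, mul_neg, mul_assoc]
  have hpos : 0 ≤ star y⁻ * y⁻ * y⁻ := star_left_conjugate_nonneg hn _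
  have h1 := h y⁻
  rw [e, map_neg, Complex.neg_re] at h1
  obtain ⟨h2, h3⟩ := φ.state_pos _ hpos
  have h4 := φ.faithful _ hpos (Complex.ext (by rw [Complex.zero_re]; linarith) h3)
  have h5 : y⁻ * y⁻ = 0 := by
    rw [← norm_eq_zero, ← mul_self_eq_zero, ← CStarRing.norm_star_mul_self, star_mul, hns,
      ← mul_assoc]
    rw [hns] at h4
    rw [h4, zero_mul, norm_zero]
  have h6 : y⁻ = 0 := by
    rw [← norm_eq_zero, ← mul_self_eq_zero, ← CStarRing.norm_star_mul_self, hns, h5, norm_zero]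
  rw [← CFC.posPart_sub_negPart y hy, h6, sub_zero]
  exact CFC.posPart_nonneg y

lemma TracialState.norm_le_of_isSelfAdjoint {y : A} (hy : IsSelfAdjoint y) {κ : ℝ} (hκ : 0 ≤ κ)
    (h : ∀ x : A, |(φ.tr (star x * y * x)).re| ≤ κ * (φ.tr (star x * x)).re) : ‖y‖ ≤ κ := by
  have hk : IsSelfAdjoint (κ • (1 : A)) :=
    (smul_nonneg hκ (zero_le_one (α := A))).isSelfAdjoint
  have e : ∀ x : A, (φ.tr (star x * (κ • (1 : A)) * x)).re = κ * (φ.tr (star x * x)).re := by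
    intro x
    rw [mul_smul_comm, smul_mul_assoc, mul_one, ← Complex.coe_smul, map_smul, smul_eq_mul,
      Complex.re_ofReal_mul]
  refine norm_le_of_le_smul_one hy hκ ?_ ?_
  · refine sub_nonneg.1 (φ.nonneg_of_re_conj_nonneg (hk.sub hy) fun x => ?_)
    rw [mul_sub, sub_mul, map_sub, Complex.sub_re, e]
    linarith [(abs_le.1 (h x)).2]
  · refine sub_nonneg.1 (φ.nonneg_of_re_conj_nonneg (hk.sub hy.neg) fun x => ?_)
    rw [mul_sub, sub_mul, map_sub, Complex.sub_re, e, mul_neg, neg_mul, map_neg, Complex.neg_re]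
    linarith [(abs_le.1 (h x)).1]

lemma TracialState.norm_le_of_norm_conj_le {y : A} {κ : ℝ} (hκ : 0 ≤ κ)
    (h : ∀ x : A, ‖φ.tr (star x * y * x)‖ ≤ κ * (φ.tr (star x * x)).re) : ‖y‖ ≤ 2 * κ := by
  have h1 : ‖reA y‖ ≤ κ := by
    refine φ.norm_le_of_isSelfAdjoint (isSelfAdjoint_reA y) hκ fun x => ?_
    rw [← reA_star_mul_mul, φ.re_tr_reA]
    exact (Complex.abs_re_le_norm _).trans (h x)
  have h2 : ‖imA y‖ ≤ κ := by
    refine φ.norm_le_of_isSelfAdjoint (isSelfAdjoint_imA y) hκ fun x => ?_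
    rw [← imA_star_mul_mul, φ.re_tr_imA]
    exact (Complex.abs_im_le_norm _).trans (h x)
  linarith [norm_le_reA_add_imA y]

end Trace

section Stieltjes

lemma ofReal_sub_ne_zero {z : ℂ} (hz : 0 < z.im) (t : ℝ) : (t : ℂ) - z ≠ 0 := by
  intro h
  have := congrArg Complex.im h
  simp at this
  exact hz.ne' this

lemma im_le_norm_ofReal_sub (z : ℂ) (t : ℝ) : z.im ≤ ‖(t : ℂ) - z‖ := by
  have h := Complex.abs_im_le_norm ((t : ℂ) - z)
  simp only [Complex.sub_im, Complex.ofReal_im, zero_sub, abs_neg] at h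
  exact (le_abs_self _).trans h

lemma integrable_inv_ofReal_sub (μ : Measure ℝ) [IsFiniteMeasure μ] {z : ℂ} (hz : 0 < z.im) :
    Integrable (fun t : ℝ => ((t : ℂ) - z)⁻¹) μ := by
  refine Integrable.of_bound (C := z.im⁻¹) ?_ (Filter.Eventually.of_forall fun t => ?_)
  · exact (Continuous.inv₀ (by fun_prop) (ofReal_sub_ne_zero hz)).aestronglyMeasurable
  · rw [norm_inv]
    exact inv_anti₀ hz (im_le_norm_ofReal_sub z t)

lemma im_inv_ofReal_sub (z : ℂ) (t : ℝ) :
    (((t : ℂ) - z)⁻¹).im = z.im / ((t - z.re) ^ 2 + z.im ^ 2) := by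
  rw [Complex.inv_im, Complex.normSq_apply]
  simp
  ring

/-- A finite measure with a uniform quadratic bound on the mass of short intervals around points
of an interval gives no mass to that interval. -/
lemma measure_Ioo_eq_zero_of_quadratic_bound (μ : Measure ℝ) [IsFiniteMeasure μ] {τ δ C : ℝ}
    (hδ : 0 < δ)
    (h : ∀ σ η : ℝ, |σ - τ| ≤ δ → 0 < η → η ≤ δ → μ.real (Set.Ioo (σ - η) (σ + η)) ≤ C * η ^ 2) :
    μ (Set.Ioo (τ - δ) (τ + δ)) = 0 := by
  have key : ∀ n : ℕ, μ.real (Set.Ioo (τ - δ) (τ + δ))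
      ≤ (2 * C * δ ^ 2) * (1 / ((n : ℝ) + 1)) := by
    intro n
    set N : ℝ := (n : ℝ) + 1 with hN
    have hN0 : 0 < N := by positivity
    set η := δ / N with hη
    have hη0 : 0 < η := by positivity
    have hηδ : η ≤ δ := div_le_self hδ.le (by rw [hN]; linarith [n.cast_nonneg (α := ℝ)])
    have hηN : η * N = δ := div_mul_cancel₀ _ hN0.ne'
    set σ : ℕ → ℝ := fun k => τ - δ + (k + 1) * η with hσ
    have hcover : Set.Ioo (τ - δ) (τ + δ)
        ⊆ ⋃ k ∈ Finset.range (2 * (n + 1)), Set.Ioo (σ k - η) (σ k + η) := by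
      intro t ht
      have h0 : 0 ≤ (t - (τ - δ)) / η := div_nonneg (by linarith [ht.1]) hη0.le
      have h1 := Nat.le_ceil ((t - (τ - δ)) / η)
      have h2 := Nat.ceil_lt_add_one h0
      have h3 : 0 < ⌈(t - (τ - δ)) / η⌉₊ := Nat.ceil_pos.2 (div_pos (by linarith [ht.1]) hη0)
      have h4 : ⌈(t - (τ - δ)) / η⌉₊ ≤ 2 * (n + 1) := by
        refine Nat.ceil_le.2 ?_
        rw [div_le_iff₀ hη0]
        push_cast
        rw [← hN]
        nlinarith [ht.2]
      obtain ⟨k, hk⟩ := Nat.exists_eq_add_of_lt h3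
      rw [zero_add] at hk
      rw [hk] at h1 h2 h4
      rw [div_le_iff₀ hη0] at h1
      rw [← sub_lt_iff_lt_add, lt_div_iff₀ hη0] at h2
      push_cast at h1 h2
      refine Set.mem_biUnion (Finset.mem_coe.2 (Finset.mem_range.2 h4)) ⟨?_, ?_⟩ <;>
        simp only [hσ] <;> linarith
    have hb : ∀ k ∈ Finset.range (2 * (n + 1)),
        μ.real (Set.Ioo (σ k - η) (σ k + η)) ≤ C * η ^ 2 := by
      intro k hk
      refine h _ _ ?_ hη0 hηδ
      have hk' : (k : ℝ) + 1 ≤ 2 * N := by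
        rw [hN]
        exact_mod_cast Finset.mem_range.1 hk
      have h1 : ((k : ℝ) + 1) * η ≤ 2 * N * η := mul_le_mul_of_nonneg_right hk' hη0.le
      have h2 : 0 ≤ ((k : ℝ) + 1) * η := by positivity
      rw [abs_le]
      constructor <;> simp only [hσ] <;> nlinarith
    calc μ.real (Set.Ioo (τ - δ) (τ + δ))
        ≤ μ.real (⋃ k ∈ Finset.range (2 * (n + 1)), Set.Ioo (σ k - η) (σ k + η)) :=
          measureReal_mono hcover (measure_ne_top μ _)
      _ ≤ ∑ k ∈ Finset.range (2 * (n + 1)), μ.real (Set.Ioo (σ k - η) (σ k + η)) :=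
          measureReal_biUnion_finset_le _ _
      _ ≤ (Finset.range (2 * (n + 1))).card • (C * η ^ 2) := Finset.sum_le_card_nsmul _ _ _ hb
      _ = (2 * C * δ ^ 2) * (1 / N) := by
          rw [Finset.card_range, nsmul_eq_mul, hη]
          push_cast
          rw [← hN]
          field_simp
  have hlim := (tendsto_one_div_add_atTop_nhds_zero_nat (𝕜 := ℝ)).const_mul (2 * C * δ ^ 2)
  rw [mul_zero] at hlim
  have h0 := ge_of_tendsto' hlim key
  exact (measureReal_eq_zero_iff).1 (le_antisymm h0 measureReal_nonneg)

end Stieltjes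

section Representation

variable {A : Type*} [CStarAlgebra A] [PartialOrder A] [StarOrderedRing A] {φ : TracialState A}
  {v : OpMeasure A φ} {m : ℂ → A}

omit [StarOrderedRing A] in
lemma OpMeasure.real_scalar_univ (hv : v.val Set.univ = 1) (x : A) :
    (v.scalar x).real Set.univ = (φ.tr (star x * x)).re := by
  have h := v.compat x Set.univ MeasurableSet.univ
  rw [hv, mul_one] at h
  rw [h, Complex.ofReal_re, measureReal_def]

omit [StarOrderedRing A] in
lemma OpMeasure.scalar_eq_zero_of_dos_eq_zero {B : Set ℝ} (hB : MeasurableSet B)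
    (h : v.dos B = 0) (x : A) : v.scalar x B = 0 := by
  have h1 := v.compat 1 B hB
  rw [star_one, one_mul, mul_one] at h1
  rw [OpMeasure.dos] at h
  rw [h] at h1
  have h2 := φ.faithful _ (v.nonneg B) (by simpa using h1)
  have h3 := v.compat x B hB
  rw [h2, mul_zero, zero_mul, map_zero, eq_comm, Complex.ofReal_eq_zero] at h3
  have := v.scalarFin x
  exact (ENNReal.toReal_eq_zero_iff _).1 h3 |>.resolve_right (measure_ne_top _ _)

lemma StieltjesRep.re_tr_imA (hrep : StieltjesRep φ v m) {z : ℂ} (hz : 0 < z.im) (x : A) :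
    (φ.tr (star x * imA (m z) * x)).re
      = ∫ t : ℝ, z.im / ((t - z.re) ^ 2 + z.im ^ 2) ∂(v.scalar x) := by
  have := v.scalarFin x
  rw [← imA_star_mul_mul, φ.re_tr_imA, hrep z hz x]
  have h := Complex.imCLM.integral_comp_comm (integrable_inv_ofReal_sub (v.scalar x) hz)
  simp only [Complex.imCLM_apply, im_inv_ofReal_sub] at h
  exact h.symm

lemma StieltjesRep.norm_sub_le (hrep : StieltjesRep φ v m) (hv : v.val Set.univ = 1) {z w : ℂ}
    (hz : 0 < z.im) (hw : 0 < w.im) : ‖m z - m w‖ ≤ 2 * (‖z - w‖ / (z.im * w.im)) := by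
  refine φ.norm_le_of_norm_conj_le (by positivity) fun x => ?_
  have := v.scalarFin x
  rw [mul_sub, sub_mul, map_sub, hrep z hz, hrep w hw,
    ← integral_sub (integrable_inv_ofReal_sub _ hz) (integrable_inv_ofReal_sub _ hw),
    ← OpMeasure.real_scalar_univ hv x]
  refine norm_integral_le_of_norm_le_const (Filter.Eventually.of_forall fun t => ?_)
  rw [inv_sub_inv (ofReal_sub_ne_zero hz t) (ofReal_sub_ne_zero hw t), norm_div, norm_mul,
    sub_sub_sub_cancel_left]
  exact div_le_div_of_nonneg_left (norm_nonneg _) (by positivity)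
    (mul_le_mul (im_le_norm_ofReal_sub z t) (im_le_norm_ofReal_sub w t) hw.le (norm_nonneg _))

lemma StieltjesRep.continuousOn (hrep : StieltjesRep φ v m) (hv : v.val Set.univ = 1) :
    ContinuousOn m {z : ℂ | 0 < z.im} := by
  intro w hw
  rw [ContinuousWithinAt, tendsto_iff_norm_sub_tendsto_zero]
  have hlim : Filter.Tendsto (fun z : ℂ => 2 * (‖z - w‖ / (z.im * w.im)))
      (nhdsWithin w {z : ℂ | 0 < z.im}) (nhds (2 * (‖w - w‖ / (w.im * w.im)))) := by
    refine Filter.Tendsto.mono_left ?_ nhdsWithin_le_nhds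
    have hw' : w.im * w.im ≠ 0 := (mul_pos hw hw).ne'
    have : ContinuousAt (fun z : ℂ => 2 * (‖z - w‖ / (z.im * w.im))) w := by
      refine ContinuousAt.mul continuousAt_const (ContinuousAt.div (by fun_prop) ?_ hw')
      exact (Complex.continuous_im.mul continuous_const).continuousAt
    exact this
  rw [sub_self, norm_zero, zero_div, mul_zero] at hlim
  refine squeeze_zero' (Filter.Eventually.of_forall fun _ => norm_nonneg _) ?_ hlim
  filter_upwards [self_mem_nhdsWithin] with z hz
  exact hrep.norm_sub_le hv hz hw

/-- Away from the support of `ρ`, the norm of `Im m` is of order `Im z`. -/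
lemma StieltjesRep.norm_imA_le_of_dos_eq_zero (hrep : StieltjesRep φ v m)
    (hv : v.val Set.univ = 1) {ε : ℝ} (hε : 0 < ε) {z : ℂ} (hz : 0 < z.im)
    (h : v.dos (Set.Ioo (z.re - ε) (z.re + ε)) = 0) : ‖imA (m z)‖ ≤ z.im / ε ^ 2 := by
  refine φ.norm_le_of_isSelfAdjoint (isSelfAdjoint_imA _) (by positivity) fun x => ?_
  have := v.scalarFin x
  rw [hrep.re_tr_imA hz, ← OpMeasure.real_scalar_univ hv x, ← Real.norm_eq_abs]
  refine norm_integral_le_of_norm_le_const ?_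
  have h0 := OpMeasure.scalar_eq_zero_of_dos_eq_zero measurableSet_Ioo h x
  filter_upwards [measure_eq_zero_iff_ae_notMem.1 h0] with t ht
  have ht' : ε ^ 2 ≤ (t - z.re) ^ 2 := by
    rw [sq_le_sq, abs_of_pos hε]
    by_contra hlt
    rw [not_le, abs_lt] at hlt
    exact ht ⟨by linarith [hlt.1], by linarith [hlt.2]⟩
  rw [Real.norm_of_nonneg (by positivity)]
  exact div_le_div_of_nonneg_left hz.le (by positivity) (by nlinarith [sq_nonneg z.im])

lemma StieltjesRep.real_dos_Ioo_le (hrep : StieltjesRep φ v m) {z : ℂ} (hz : 0 < z.im) :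
    v.dos.real (Set.Ioo (z.re - z.im) (z.re + z.im)) ≤ 2 * z.im * ‖imA (m z)‖ := by
  have := v.scalarFin 1
  have h1 := hrep.re_tr_imA hz 1
  rw [star_one, one_mul, mul_one] at h1
  have h2 := φ.re_le_norm (isSelfAdjoint_imA (m z))
  have hint : Integrable (fun t : ℝ => z.im / ((t - z.re) ^ 2 + z.im ^ 2)) (v.scalar 1) := by
    have := Complex.imCLM.integrable_comp (integrable_inv_ofReal_sub (v.scalar 1) hz)
    simpa only [Complex.imCLM_apply, im_inv_ofReal_sub] using this
  have h3 := mul_meas_ge_le_integral_of_nonneg (μ := v.scalar 1)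
    (Filter.Eventually.of_forall fun t => by positivity) hint (1 / (2 * z.im))
  have h4 : (v.scalar 1).real (Set.Ioo (z.re - z.im) (z.re + z.im))
      ≤ (v.scalar 1).real {t : ℝ | 1 / (2 * z.im) ≤ z.im / ((t - z.re) ^ 2 + z.im ^ 2)} := by
    refine measureReal_mono fun t ht => ?_
    rw [Set.mem_ofPred_eq, div_le_div_iff₀ (by positivity) (by positivity)]
    nlinarith [mul_pos (sub_pos.2 ht.1) (sub_pos.2 ht.2)]
  rw [OpMeasure.dos]
  rw [← h1, one_div_mul_eq_div, div_le_iff₀' (by positivity)] at h3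
  exact h4.trans (h3.trans (mul_le_mul_of_nonneg_left h2 (by positivity)))

end Representation

end Dyson

open Dyson in
/-- **Corollary (characterization of `supp ρ`).**
Under boundedness and upper flatness of the data pair, for every `τ ∈ ℝ` one has
`lim_{η↓0} η/‖Im m(τ+iη)‖ = 0` if and only if `τ` lies in the support of the
self-consistent density of states. -/
theorem support_characterization
    {A : Type*} [CStarAlgebra A] [PartialOrder A] [StarOrderedRing A]
    (φ : TracialState A) (k₀ k₁ : ℝ) (hk₀ : 0 < k₀) (hk₁ : 0 < k₁)
    (a : A) (S : A →L[ℂ] A) (m : ℂ → A) (v : OpMeasure A φ)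
    (ha : IsSelfAdjoint a) (hna : ‖a‖ ≤ k₀)
    (hS : PosPreserving S) (hSsym : SymmOp φ S)
    (hupper : ∀ x : A, 0 ≤ x → S x ≤ Complex.ofReal (k₁ * (φ.tr x).re) • (1 : A))
    (hm : IsDysonSolution a S m)
    (hv : v.val Set.univ = 1) (hrep : StieltjesRep φ v m) :
    ∀ τ : ℝ,
      Filter.Tendsto
        (fun η : ℝ => η / ‖imA (m ((τ : ℂ) + (η : ℂ) * Complex.I))‖)
        (nhdsWithin 0 (Set.Ioi 0)) (nhds 0)
      ↔ τ ∈ measSupp v.dos := by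
  intro τ
  have := φ.nontrivial
  have him : ∀ η : ℝ, ((τ : ℂ) + (η : ℂ) * Complex.I).im = η := fun η => by simp
  have hre : ∀ η : ℝ, ((τ : ℂ) + (η : ℂ) * Complex.I).re = τ := fun η => by simp
  constructor
  · intro hlim
    by_contra hτ
    simp only [measSupp, Set.mem_ofPred_eq, not_forall, not_not] at hτ
    obtain ⟨ε, hε, h0⟩ := hτ
    have hev := hlim.eventually_lt_const (pow_pos hε 2)
    obtain ⟨η, hη, hη0⟩ := (hev.and self_mem_nhdsWithin).exists
    have hz : 0 < ((τ : ℂ) + (η : ℂ) * Complex.I).im := by rwa [him]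
    have h1 := hrep.norm_imA_le_of_dos_eq_zero hv hε hz (by rwa [hre])
    have hpos : 0 < ‖imA (m ((τ : ℂ) + (η : ℂ) * Complex.I))‖ := by
      refine norm_pos_iff.2 fun h => ?_
      obtain ⟨κ, hκ, hle⟩ := (hm _ hz).1
      rw [h, Complex.coe_smul] at hle
      have h2 : κ • (1 : A) = 0 := le_antisymm hle (smul_nonneg hκ.le zero_le_one)
      exact (smul_ne_zero hκ.ne' one_ne_zero) h2
    rw [him, le_div_iff₀ (pow_pos hε 2)] at h1
    rw [div_lt_iff₀ hpos] at hη
    linarith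
  · intro hτ
    by_contra hlim
    rw [Metric.tendsto_nhds] at hlim
    push Not at hlim
    obtain ⟨c, hc, hfreq⟩ := hlim
    obtain ⟨δ, hδ, C', hC', hbound⟩ := hm.exists_local_bound ha hS (hrep.continuousOn hv) (τ : ℂ)
      (inv_pos.2 hc)
    obtain ⟨η, hη, hη0, hηδ⟩ := (hfreq.and_eventually (Ioo_mem_nhdsGT hδ)).exists
    have hnorm : ‖imA (m ((τ : ℂ) + (η : ℂ) * Complex.I))‖ ≤ c⁻¹ * η := by
      rw [Real.dist_eq, sub_zero, abs_of_nonneg (div_nonneg hη0.le (norm_nonneg _))] at hη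
      rcases (norm_nonneg (imA (m ((τ : ℂ) + (η : ℂ) * Complex.I)))).eq_or_lt with h | h
      · rw [← h]
        positivity
      · rw [le_div_iff₀ h] at hη
        rwa [inv_mul_eq_div, le_div_iff₀' hc]
    have hloc := hbound ((τ : ℂ) + (η : ℂ) * Complex.I) (by rwa [him])
      (by simpa [abs_of_pos hη0] using hηδ) (by rwa [him]) (by rwa [him])
    have : IsFiniteMeasure v.dos := v.scalarFin 1
    refine hτ (δ / 4) (by positivity)
      (measure_Ioo_eq_zero_of_quadratic_bound v.dos (C := 2 * C') (by positivity) ?_)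
    intro σ κ hσ hκ0 hκ
    have hz : 0 < ((σ : ℂ) + (κ : ℂ) * Complex.I).im := by simpa using hκ0
    have h1 := hrep.real_dos_Ioo_le hz
    have hdist : ‖(σ : ℂ) + (κ : ℂ) * Complex.I - τ‖ < δ := by
      have e : (σ : ℂ) + (κ : ℂ) * Complex.I - τ = ((σ - τ : ℝ) : ℂ) + (κ : ℂ) * Complex.I := by
        push_cast
        ring
      rw [e]
      refine (norm_add_le _ _).trans_lt ?_
      rw [norm_mul, Complex.norm_I, mul_one, Complex.norm_real, Complex.norm_real,
        Real.norm_eq_abs, Real.norm_of_nonneg hκ0.le]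
      linarith
    have h2 := hloc _ hz hdist
    have e1 : ((σ : ℂ) + (κ : ℂ) * Complex.I).re = σ := by simp
    have e2 : ((σ : ℂ) + (κ : ℂ) * Complex.I).im = κ := by simp
    rw [e1, e2] at h1
    rw [e2] at h2
    nlinarith [mul_le_mul_of_nonneg_left h2 (by positivity : 0 ≤ 2 * κ)]
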